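/- Let f : ℝ^d → ℝ be twice continuously differentiable, bounded below, and satisfy the local PL condition at a local minimizer x*. Assume there exist constants 0 < μ ≤ L such that in some neighborhood of x*, every nonzero eigenvalue of the Hessian ∇²f(x') lies in [μ, L] for every x' ∈ 𝒮 in that neighborhood. Fix a damping parameter γ > 0 and set ρ_γ := (γ − √(max{0, γ² − 4μ}))/2. Then for every sufficiently small ε > 0 there exist an open neighborhood 𝒰 ⊂ ℝ^d × ℝ^d of (x*, 0) and a constant C_ε > 0 such that every twice differentiable trajectory x : [0,∞) → ℝ^d solving the Heavy Ball equation ẍ(t) + γ ẋ(t) + ∇f(x(t)) = 0 with (x(0), ẋ(0)) ∈ 𝒰 converges to some local minimizer x' ∈ 𝒮 and satisfies ‖x(t) − x'‖ ≤ C_ε (‖x(0) − x'‖ + ‖ẋ(0)‖) e^{−(ρ_γ − ε) t} for all t ≥ 0. -/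

import Mathlib

/-- `f` satisfies the local Polyak–Łojasiewicz condition at the local minimizer `xs`. -/
def LocalPL {d : ℕ} (f : EuclideanSpace ℝ (Fin d) → ℝ) (xs : EuclideanSpace ℝ (Fin d)) : Prop :=
  ∃ U : Set (EuclideanSpace ℝ (Fin d)), IsOpen U ∧ xs ∈ U ∧
    ∃ ν : ℝ, 0 < ν ∧ ∀ x ∈ U, 2 * ν * (f x - f xs) ≤ ‖gradient f x‖ ^ 2

/-- `𝒮`: the set of local minimizers of `f` at the same level as `xs`. -/
def minSet {d : ℕ} (f : EuclideanSpace ℝ (Fin d) → ℝ) (xs : EuclideanSpace ℝ (Fin d)) :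
    Set (EuclideanSpace ℝ (Fin d)) :=
  {p | IsLocalMin f p ∧ f p = f xs}

/-- `(x, v)` is a twice differentiable trajectory of the Heavy Ball flow
`ẍ + γ ẋ + ∇f(x) = 0` on `[0, ∞)`, with `v = ẋ`. -/
def IsHeavyBall {d : ℕ} (f : EuclideanSpace ℝ (Fin d) → ℝ) (γ : ℝ)
    (x v : ℝ → EuclideanSpace ℝ (Fin d)) : Prop :=
  (∀ t ∈ Set.Ici (0 : ℝ), HasDerivWithinAt x (v t) (Set.Ici (0 : ℝ)) t) ∧
  (∀ t ∈ Set.Ici (0 : ℝ),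
    HasDerivWithinAt v (-(γ • v t) - gradient f (x t)) (Set.Ici (0 : ℝ)) t)

section HeavyBall

open Set Filter Topology
open scoped RealInnerProductSpace

variable {E : Type*} [NormedAddCommGroup E] [InnerProductSpace ℝ E]

theorem contDiff_gradient [CompleteSpace E] {f : E → ℝ} (hf : ContDiff ℝ 2 f) :
    ContDiff ℝ 1 (gradient f) := by
  have h : ContDiff ℝ 1 (fderiv ℝ f) := hf.fderiv_right (by norm_num)
  exact (InnerProductSpace.toDual ℝ E).symm.toContinuousLinearEquiv.toContinuousLinearMap.contDiff.comp h

theorem inner_fderiv_gradient_comm [CompleteSpace E] {f : E → ℝ} (hf : ContDiff ℝ 2 f)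
    (p v w : E) :
    ⟪fderiv ℝ (gradient f) p v, w⟫ = ⟪v, fderiv ℝ (gradient f) p w⟫ := by
  have hd : DifferentiableAt ℝ (gradient f) p :=
    (contDiff_gradient hf).differentiable (by norm_num) p
  have hd2 : DifferentiableAt ℝ (fderiv ℝ f) p :=
    (hf.fderiv_right (m := 1) (by norm_num)).differentiable (by norm_num) p
  have key : ∀ a b : E, ⟪fderiv ℝ (gradient f) p a, b⟫ = fderiv ℝ (fderiv ℝ f) p a b := by
    intro a b
    have h1 : HasFDerivAt (fun x => ⟪gradient f x, b⟫)
        ((innerSL ℝ b).comp (fderiv ℝ (gradient f) p)) p := by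
      have := (innerSL ℝ b).hasFDerivAt.comp p hd.hasFDerivAt
      refine this.congr_of_eventuallyEq (Eventually.of_forall fun x => ?_)
      simp
    have h2 : HasFDerivAt (fun x => ⟪gradient f x, b⟫)
        ((ContinuousLinearMap.apply ℝ ℝ b).comp (fderiv ℝ (fderiv ℝ f) p)) p := by
      have := (ContinuousLinearMap.apply ℝ ℝ b).hasFDerivAt.comp p hd2.hasFDerivAt
      refine this.congr_of_eventuallyEq (Eventually.of_forall fun x => ?_)
      simp [inner_gradient_left]
    have := DFunLike.congr_fun (h1.unique h2) a
    simpa [real_inner_comm] using this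
  have hs : IsSymmSndFDerivAt ℝ f p := hf.contDiffAt.isSymmSndFDerivAt (by simp)
  rw [key, real_inner_comm, key]
  exact hs.eq v w

/-- The kernel projection and pseudo-inverse of a symmetric operator whose nonzero eigenvalues are
at least `μ`. -/
theorem exists_kernel_projection_pseudoinverse [FiniteDimensional ℝ E] (H : E →L[ℝ] E)
    (hH : ∀ v w, ⟪H v, w⟫ = ⟪v, H w⟫) {μ : ℝ}
    (hμ : ∀ c : ℝ, c ≠ 0 → (∃ v, v ≠ 0 ∧ H v = c • v) → μ ≤ c) :
    ∃ P T : E →L[ℝ] E, (∀ v, H (P v) = 0) ∧ (∀ v w, P v = 0 → ⟪P w, v⟫ = 0) ∧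
      (∀ v, ⟪P v, v⟫ = ‖P v‖ ^ 2) ∧ (∀ w, H (T w) = w - P w) ∧ (∀ v, T (H v) = v - P v) ∧
      (∀ w, P (T w) = 0) ∧ (∀ z, P z = 0 → μ * ‖z‖ ^ 2 ≤ ⟪z, H z⟫) := by
  set K := H.ker
  set P := K.starProjection
  have hmem : ∀ v, H (P v) = 0 := fun v => K.starProjection_apply_mem v
  have hPP : ∀ v, P (P v) = P v := fun v =>
    Submodule.starProjection_eq_self_iff.2 (K.starProjection_apply_mem v)
  have hPs : ∀ v w, ⟪P v, w⟫ = ⟪v, P w⟫ := K.inner_starProjection_left_eq_right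
  have hPH : ∀ v, P (H v) = 0 := by
    intro v
    rw [Submodule.starProjection_apply_eq_zero_iff, Submodule.mem_orthogonal']
    intro u hu
    rw [hH, show H u = 0 from hu, inner_zero_right]
  have hinj : Function.Injective (H + P).toLinearMap := by
    rw [← LinearMap.ker_eq_bot, LinearMap.ker_eq_bot']
    intro v hv
    have hv : H v + P v = 0 := hv
    have h1 : P v = 0 := by simpa [hPH, hPP] using congrArg P hv
    have h2 : H v = 0 := by simpa [h1] using hv
    have h3 : P v = v := Submodule.starProjection_eq_self_iff.2 h2
    rw [← h3, h1]
  let e : E ≃ₗ[ℝ] E := LinearEquiv.ofInjectiveEndo _ hinj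
  have he : ∀ v, e v = H v + P v := fun v => rfl
  let T : E →L[ℝ] E := (LinearMap.toContinuousLinearMap e.symm.toLinearMap).comp
    (ContinuousLinearMap.id ℝ E - P)
  have hT : ∀ w, T w = e.symm (w - P w) := fun w => rfl
  have heT : ∀ w, H (T w) + P (T w) = w - P w := fun w => by
    rw [← he, hT, LinearEquiv.apply_symm_apply]
  have hPT : ∀ w, P (T w) = 0 := fun w => by
    simpa [hPH, hPP] using congrArg P (heT w)
  refine ⟨P, T, hmem, ?_, ?_, ?_, ?_, hPT, ?_⟩
  · intro v w hv
    rw [hPs, hv, inner_zero_right]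
  · intro v
    rw [← hPP v, hPs, hPP, real_inner_self_eq_norm_sq]
  · intro w
    simpa [hPT] using heT w
  · intro v
    rw [hT, hPH, sub_zero, LinearEquiv.symm_apply_eq, he]
    simp [hmem, hPP]
  · intro z hz
    have hsym : H.toLinearMap.IsSymmetric := hH
    set b := hsym.eigenvectorBasis rfl
    have hb : ∀ i, H (b i) = hsym.eigenvalues rfl i • b i := fun i =>
      hsym.apply_eigenvectorBasis rfl i
    rw [← b.sum_sq_norm_inner_right z, ← b.sum_inner_mul_inner z (H z), Finset.mul_sum]
    refine Finset.sum_le_sum fun i _ => ?_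
    rw [← hH, hb, real_inner_smul_left, real_inner_comm, Real.norm_eq_abs, sq_abs]
    rcases eq_or_ne (hsym.eigenvalues rfl i) 0 with h0 | h0
    · have h1 : P (b i) = b i := Submodule.starProjection_eq_self_iff.2 (by
        show H (b i) = 0
        rw [hb, h0, zero_smul])
      rw [← h1, ← hPs, hz]
      simp
    · have := hμ _ h0 ⟨b i, b.orthonormal.ne_zero i, hb i⟩
      nlinarith [mul_le_mul_of_nonneg_right this (sq_nonneg ⟪b i, z⟫)]

/-- Near a local minimizer satisfying the Polyak–Łojasiewicz inequality, the component of the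
gradient in the kernel of the Hessian is negligible. -/
theorem exists_ball_gradient_estimates [CompleteSpace E] {f : E → ℝ} (hf : ContDiff ℝ 2 f)
    {xs : E} (hmin : IsLocalMin f xs) {ν : ℝ} (hν : 0 < ν)
    (hPL : ∀ᶠ x in 𝓝 xs, 2 * ν * (f x - f xs) ≤ ‖gradient f x‖ ^ 2) (P : E →L[ℝ] E)
    (hHP : ∀ v, fderiv ℝ (gradient f) xs (P v) = 0) (hP : ∀ v, ⟪P v, v⟫ = ‖P v‖ ^ 2)
    {η : ℝ} (hη : 0 < η) :
    ∃ r > 0, ∀ y ∈ Metric.ball xs r, f xs ≤ f y ∧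
      2 * ν * (f y - f xs) ≤ ‖gradient f y‖ ^ 2 ∧
      ‖fderiv ℝ (gradient f) y - fderiv ℝ (gradient f) xs‖ ≤ η ∧
      ‖P (gradient f y)‖ ≤ η * ‖gradient f y‖ := by
  set g := gradient f
  have hg : ContDiff ℝ 1 g := contDiff_gradient hf
  have hgd : Differentiable ℝ g := hg.differentiable (by norm_num)
  obtain ⟨δ, hδ, hδη, hδν⟩ : ∃ δ > 0, δ ≤ η ∧ 2 * δ ≤ ν * η ^ 2 := by
    refine ⟨min η (ν * η ^ 2 / 2), by positivity, min_le_left _ _, ?_⟩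
    linarith [min_le_right η (ν * η ^ 2 / 2)]
  have hcont : ∀ᶠ y in 𝓝 xs, ‖fderiv ℝ g y - fderiv ℝ g xs‖ ≤ δ := by
    have h := (hg.continuous_fderiv (by norm_num)).tendsto xs
    filter_upwards [Metric.tendsto_nhds.1 h δ hδ] with y hy
    rw [← dist_eq_norm]; exact hy.le
  obtain ⟨R, hR, hball⟩ := Metric.eventually_nhds_iff_ball.1 ((hcont.and hPL).and hmin)
  have hgxs : g xs = 0 := by
    simp [g, gradient, hmin.fderiv_eq_zero]
  have hsmall : ∀ᶠ y in 𝓝 xs, ‖P (g y)‖ < δ * R := by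
    have h : Tendsto (fun y => ‖P (g y)‖) (𝓝 xs) (𝓝 ‖P (g xs)‖) :=
      (P.continuous.comp hg.continuous).norm.tendsto xs
    rw [hgxs, map_zero, norm_zero] at h
    exact h.eventually_lt_const (by positivity)
  obtain ⟨r, hr, hrball⟩ := Metric.eventually_nhds_iff_ball.1 hsmall
  refine ⟨min r (R / 2), by positivity, fun y hy => ?_⟩
  have hyr : y ∈ Metric.ball xs r := Metric.ball_subset_ball (min_le_left _ _) hy
  have hyR2 : ‖y - xs‖ < R / 2 := by
    rw [← dist_eq_norm]; exact lt_of_lt_of_le hy (min_le_right _ _)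
  have hyR : y ∈ Metric.ball xs R := by rw [mem_ball_iff_norm]; linarith
  obtain ⟨⟨hy1, hy2⟩, hy3⟩ := hball y hyR
  refine ⟨hy3, hy2, hy1.trans hδη, ?_⟩
  set u := P (g y)
  have hu : ‖u‖ < δ * R := hrball y hyr
  have hseg : ∀ s ∈ Icc (0 : ℝ) (1 / (2 * δ)), y - s • u ∈ Metric.ball xs R := by
    intro s hs
    rw [mem_ball_iff_norm]
    have h1 : ‖y - s • u - xs‖ ≤ ‖y - xs‖ + s * ‖u‖ := by
      have := norm_sub_le (y - xs) (s • u)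
      rw [norm_smul, Real.norm_of_nonneg hs.1] at this
      rwa [sub_right_comm] at this
    have h2 : s * ‖u‖ ≤ 1 / (2 * δ) * (δ * R) :=
      mul_le_mul hs.2 hu.le (norm_nonneg _) (by positivity)
    have h3 : 1 / (2 * δ) * (δ * R) = R / 2 := by field_simp
    linarith
  have hderiv : ∀ s, HasDerivAt (fun s : ℝ => f (y - s • u) + s * (‖u‖ ^ 2 / 2))
      (-⟪g (y - s • u), u⟫ + ‖u‖ ^ 2 / 2) s := by
    intro s
    have h1 : HasDerivAt (fun s : ℝ => y - s • u) (-u) s := by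
      simpa using ((hasDerivAt_id s).smul_const u).const_sub y
    have h2 : HasFDerivAt f (fderiv ℝ f (y - s • u)) (y - s • u) :=
      (hf.differentiable (by norm_num) _).hasFDerivAt
    have h3 := h2.comp_hasDerivAt s h1
    have h4 : HasDerivAt (fun s : ℝ => s * (‖u‖ ^ 2 / 2)) (‖u‖ ^ 2 / 2) s := by
      simpa using (hasDerivAt_id s).mul_const (‖u‖ ^ 2 / 2)
    rw [inner_gradient_left, ← map_neg]
    exact h3.add h4
  have hanti : AntitoneOn (fun s : ℝ => f (y - s • u) + s * (‖u‖ ^ 2 / 2))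
      (Icc 0 (1 / (2 * δ))) := by
    refine antitoneOn_of_hasDerivWithinAt_nonpos (convex_Icc _ _)
      (fun s _ => (hderiv s).continuousAt.continuousWithinAt)
      (fun s _ => (hderiv s).hasDerivWithinAt) fun s hs => ?_
    rw [interior_Icc] at hs
    have hs' : s ∈ Icc (0 : ℝ) (1 / (2 * δ)) := Ioo_subset_Icc_self hs
    have h1 := (convex_ball xs R).norm_image_sub_le_of_norm_fderiv_le' (f := g) (𝕜 := ℝ)
      (φ := fderiv ℝ g xs) (C := δ) (fun z _ => hgd z) (fun z hz => (hball z hz).1.1) hyR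
      (hseg s hs')
    have h2 : fderiv ℝ g xs (y - s • u - y) = 0 := by
      rw [show y - s • u - y = -(s • u) by abel, map_neg, map_smul, hHP, smul_zero, neg_zero]
    rw [h2, sub_zero, show y - s • u - y = -(s • u) by abel, norm_neg, norm_smul,
      Real.norm_of_nonneg hs'.1] at h1
    have h3 : |⟪g (y - s • u) - g y, u⟫| ≤ δ * (s * ‖u‖) * ‖u‖ :=
      (abs_real_inner_le_norm _ _).trans (mul_le_mul_of_nonneg_right h1 (norm_nonneg _))
    have h4 : ⟪g y, u⟫ = ‖u‖ ^ 2 := by rw [real_inner_comm]; exact hP _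
    rw [inner_sub_left, h4] at h3
    have h5 : s * (2 * δ) ≤ 1 := by
      have := (le_div_iff₀ (by positivity)).1 hs'.2
      exact this
    have h6 := (abs_le.1 h3).1
    nlinarith [mul_le_mul_of_nonneg_right h5 (sq_nonneg ‖u‖)]
  have hend : (0 : ℝ) ≤ 1 / (2 * δ) := by positivity
  have h1 := hanti (left_mem_Icc.2 hend) (right_mem_Icc.2 hend) hend
  have h2 : f xs ≤ f (y - (1 / (2 * δ)) • u) := (hball _ (hseg _ (right_mem_Icc.2 hend))).2
  simp only [zero_smul, sub_zero, zero_mul, add_zero] at h1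
  have h3 : ‖u‖ ^ 2 ≤ 4 * δ * (f y - f xs) := by
    have h4 : 1 / (2 * δ) * (‖u‖ ^ 2 / 2) ≤ f y - f xs := by linarith
    have h5 := mul_le_mul_of_nonneg_left h4 (show 0 ≤ 4 * δ by positivity)
    have h6 : 4 * δ * (1 / (2 * δ) * (‖u‖ ^ 2 / 2)) = ‖u‖ ^ 2 := by field_simp; norm_num
    linarith
  have h4 : ν * ‖u‖ ^ 2 ≤ ν * (η * ‖g y‖) ^ 2 := by
    have := mul_le_mul_of_nonneg_left hy2 hδ.le
    have h7 := mul_le_mul_of_nonneg_right hδν (sq_nonneg ‖g y‖)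
    nlinarith [mul_le_mul_of_nonneg_left h3 hν.le]
  exact (sq_le_sq₀ (norm_nonneg _) (by positivity)).1 (le_of_mul_le_mul_left h4 hν)

theorem lyapunov_deriv_le {s γ : ℝ} (hs : 0 ≤ s) (hsγ : 2 * s ≤ γ) {v z y b e p : E}
    (hbz : ⟪b, z⟫ = 0) (hby : ⟪b, y⟫ = 0) (hbv : ⟪b, v⟫ = ‖b‖ ^ 2) :
    2 * ⟪v + s • z, -(γ • v) - (y + p) + s • (v - b + e)⟫ + 2 * ⟪v - b + e, y⟫ +
        2 * (s ^ 2 - γ * s) * ⟪z, v - b + e⟫ ≤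
      -(2 * s) * (‖v + s • z‖ ^ 2 + ⟪z, y⟫ + (s ^ 2 - γ * s) * ‖z‖ ^ 2) +
        2 * (s * ⟪v + s • z, e⟫ + ⟪e, y⟫ + (s ^ 2 - γ * s) * ⟪z, e⟫ - ⟪v + s • z, p⟫) := by
  have h1 : 0 ≤ 2 * (γ - 2 * s) * ‖v + s • z‖ ^ 2 + 2 * s * ‖b‖ ^ 2 := by
    have : 0 ≤ γ - 2 * s := by linarith
    positivity
  have hbz' : ⟪z, b⟫ = 0 := by rw [real_inner_comm, hbz]
  have hbv' : ⟪v, b⟫ = ‖b‖ ^ 2 := by rw [real_inner_comm, hbv]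
  have hsz : ‖s • z‖ ^ 2 = s ^ 2 * ‖z‖ ^ 2 := by
    rw [norm_smul, mul_pow, Real.norm_eq_abs, sq_abs]
  rw [← real_inner_self_eq_norm_sq (v + s • z)] at h1 ⊢
  simp only [inner_add_left, inner_add_right, inner_sub_left, inner_sub_right, inner_neg_right,
    real_inner_smul_left, real_inner_smul_right, hby, hbz', hbv',
    real_inner_self_eq_norm_sq, hsz, real_inner_comm v z] at h1 ⊢
  linarith

/-- A Lyapunov function for the linear system `ż = v`, `v̇ = -γ v - H z`, with decay rate `s`. -/
noncomputable def lyapunov (H : E →L[ℝ] E) (γ s : ℝ) (z v : E) : ℝ :=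
  ‖v + s • z‖ ^ 2 + ⟪z, H z⟫ + (s ^ 2 - γ * s) * ‖z‖ ^ 2

theorem lyapunov_coercive {H : E →L[ℝ] E} {γ s μ : ℝ} (hκ : 0 < μ + (s ^ 2 - γ * s)) {z v : E}
    (hz : μ * ‖z‖ ^ 2 ≤ ⟪z, H z⟫) :
    (‖v + s • z‖ + ‖z‖) ^ 2 ≤ 2 * (1 + 1 / (μ + (s ^ 2 - γ * s))) * lyapunov H γ s z v := by
  set κ := μ + (s ^ 2 - γ * s) with hκdef
  have h1 : ‖v + s • z‖ ^ 2 + κ * ‖z‖ ^ 2 ≤ lyapunov H γ s z v := by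
    rw [lyapunov, hκdef]; linarith
  have h2 : (1 + 1 / κ) * (‖v + s • z‖ ^ 2 + κ * ‖z‖ ^ 2) =
      ‖v + s • z‖ ^ 2 + ‖z‖ ^ 2 + (‖v + s • z‖ ^ 2 / κ + κ * ‖z‖ ^ 2) := by
    field_simp
    ring
  have h3 : 0 ≤ ‖v + s • z‖ ^ 2 / κ + κ * ‖z‖ ^ 2 := by positivity
  have h4 := mul_le_mul_of_nonneg_left h1 (show 0 ≤ 1 + 1 / κ by positivity)
  nlinarith [sq_nonneg (‖v + s • z‖ - ‖z‖)]

theorem lyapunov_le {H T : E →L[ℝ] E} {γ s : ℝ} (hs : 0 ≤ s) (w v : E) :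
    lyapunov H γ s (T w) v ≤
      ((1 + s * ‖T‖) ^ 2 + (‖H‖ + |s ^ 2 - γ * s|) * ‖T‖ ^ 2) * (‖v‖ + ‖w‖) ^ 2 := by
  have hT : ‖T w‖ ≤ ‖T‖ * (‖v‖ + ‖w‖) :=
    (T.le_opNorm w).trans (mul_le_mul_of_nonneg_left (by linarith [norm_nonneg v]) (norm_nonneg _))
  have h1 : ‖v + s • T w‖ ≤ (1 + s * ‖T‖) * (‖v‖ + ‖w‖) := by
    have := norm_add_le v (s • T w)
    rw [norm_smul, Real.norm_of_nonneg hs] at this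
    nlinarith [mul_le_mul_of_nonneg_left hT hs, norm_nonneg w]
  have h2 : ⟪T w, H (T w)⟫ ≤ ‖H‖ * ‖T w‖ ^ 2 := by
    have := real_inner_le_norm (T w) (H (T w))
    nlinarith [mul_le_mul_of_nonneg_left (H.le_opNorm (T w)) (norm_nonneg (T w))]
  have h3 : (s ^ 2 - γ * s) * ‖T w‖ ^ 2 ≤ |s ^ 2 - γ * s| * ‖T w‖ ^ 2 :=
    mul_le_mul_of_nonneg_right (le_abs_self _) (sq_nonneg _)
  have h4 := pow_le_pow_left₀ (norm_nonneg _) h1 2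
  have h5 := mul_le_mul_of_nonneg_left (pow_le_pow_left₀ (norm_nonneg _) hT 2)
    (show 0 ≤ ‖H‖ + |s ^ 2 - γ * s| by positivity)
  rw [lyapunov]
  nlinarith

/-- The Lyapunov derivative bound for perturbed dynamics, with perturbations of relative size
`η`. -/
theorem lyapunov_perturbed_deriv_le {H : E →L[ℝ] E} {s γ η τ μ : ℝ} (hs : 0 ≤ s)
    (hsγ : 2 * s ≤ γ) (hη : 0 ≤ η) (hτ : 0 ≤ τ) (hκ : 0 < μ + (s ^ 2 - γ * s)) {v z b e p : E}
    (hz : μ * ‖z‖ ^ 2 ≤ ⟪z, H z⟫)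
    (hbz : ⟪b, z⟫ = 0) (hby : ⟪b, H z⟫ = 0) (hbv : ⟪b, v⟫ = ‖b‖ ^ 2)
    (he : ‖e‖ ≤ τ * η * ‖v‖) (hp : ‖p‖ ≤ 2 * ‖H‖ * η * ‖z‖) :
    2 * ⟪v + s • z, -(γ • v) - (H z + p) + s • (v - b + e)⟫ + 2 * ⟪v - b + e, H z⟫ +
        2 * (s ^ 2 - γ * s) * ⟪z, v - b + e⟫ ≤
      -(2 * s) * lyapunov H γ s z v +
        η * (4 * ((s + ‖H‖ + |s ^ 2 - γ * s|) * (τ * (1 + s)) + 2 * ‖H‖) *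
          (1 + 1 / (μ + (s ^ 2 - γ * s)))) * lyapunov H γ s z v := by
  refine (lyapunov_deriv_le hs hsγ hbz hby hbv).trans ?_
  have hco := lyapunov_coercive (v := v) hκ hz
  rw [← lyapunov]
  set N := ‖v + s • z‖ + ‖z‖
  set σ := s ^ 2 - γ * s
  have hN : 0 ≤ N := by positivity
  have huN : ‖v + s • z‖ ≤ N := by simp [N]
  have hzN : ‖z‖ ≤ N := by simp [N]
  have hvN : ‖v‖ ≤ (1 + s) * N := by
    have h := norm_sub_le (v + s • z) (s • z)
    rw [add_sub_cancel_right, norm_smul, Real.norm_of_nonneg hs] at h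
    nlinarith [mul_le_mul_of_nonneg_left hzN hs]
  have heN : ‖e‖ ≤ τ * η * ((1 + s) * N) :=
    he.trans (mul_le_mul_of_nonneg_left hvN (by positivity))
  have hpN : ‖p‖ ≤ 2 * ‖H‖ * η * N := hp.trans (mul_le_mul_of_nonneg_left hzN (by positivity))
  have hyN : ‖H z‖ ≤ ‖H‖ * N :=
    (H.le_opNorm z).trans (mul_le_mul_of_nonneg_left hzN (norm_nonneg _))
  have h1 : s * ⟪v + s • z, e⟫ ≤ s * (N * (τ * η * ((1 + s) * N))) :=
    mul_le_mul_of_nonneg_left ((real_inner_le_norm _ _).trans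
      (mul_le_mul huN heN (norm_nonneg _) hN)) hs
  have h2 : ⟪e, H z⟫ ≤ (τ * η * ((1 + s) * N)) * (‖H‖ * N) :=
    (real_inner_le_norm _ _).trans (mul_le_mul heN hyN (norm_nonneg _) (by positivity))
  have h3 : σ * ⟪z, e⟫ ≤ |σ| * (N * (τ * η * ((1 + s) * N))) := by
    refine (le_abs_self _).trans ?_
    rw [abs_mul]
    exact mul_le_mul_of_nonneg_left ((abs_real_inner_le_norm _ _).trans
      (mul_le_mul hzN heN (norm_nonneg _) hN)) (abs_nonneg _)
  have h4 : -⟪v + s • z, p⟫ ≤ N * (2 * ‖H‖ * η * N) :=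
    (neg_le_abs _).trans ((abs_real_inner_le_norm _ _).trans
      (mul_le_mul huN hpN (norm_nonneg _) hN))
  have h5 := mul_le_mul_of_nonneg_left hco
    (show 0 ≤ 2 * η * ((s + ‖H‖ + |σ|) * (τ * (1 + s)) + 2 * ‖H‖) by positivity)
  linarith

/-- While the curve stays in the ball, a decaying energy dominating the speed controls the
displacement. -/
theorem displacement_le_of_energy_decay {x v : ℝ → E} {V V' : ℝ → ℝ} {S A c τ : ℝ} (hA : 0 ≤ A)
    (hc : 0 < c)
    (hx : ∀ t ∈ Ici (0 : ℝ), HasDerivWithinAt x (v t) (Ici (0 : ℝ)) t)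
    (hV : ∀ t ∈ Ici (0 : ℝ), HasDerivWithinAt V (V' t) (Ici (0 : ℝ)) t)
    (hdecay : ∀ t ∈ Ico 0 τ, V' t ≤ -(2 * c) * V t)
    (hv : ∀ t ∈ Ico 0 τ, ‖v t‖ ^ 2 ≤ A * V t) (hS : S = √(A * V 0)) (hτ : 0 ≤ τ) :
    V τ ≤ V 0 * Real.exp (-(2 * c) * τ) ∧
      ∀ a ∈ Icc 0 τ, ‖x τ - x a‖ ≤ S / c * Real.exp (-c * a) := by
  have hexp : ∀ k t : ℝ, HasDerivAt (fun t => Real.exp (k * t)) (Real.exp (k * t) * k) t := by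
    intro k t
    simpa using ((hasDerivAt_id t).const_mul k).exp
  have hW : ∀ t ∈ Ici (0 : ℝ), HasDerivWithinAt (fun t => V t * Real.exp (2 * c * t))
      (V' t * Real.exp (2 * c * t) + V t * (Real.exp (2 * c * t) * (2 * c))) (Ici 0) t :=
    fun t ht => (hV t ht).mul (hexp _ t).hasDerivWithinAt
  have hanti : AntitoneOn (fun t => V t * Real.exp (2 * c * t)) (Icc 0 τ) := by
    refine antitoneOn_of_hasDerivWithinAt_nonpos (convex_Icc _ _)
      (fun t ht => (hW t ht.1).continuousWithinAt.mono Icc_subset_Ici_self)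
      (fun t ht => (hW t (interior_subset ht).1).mono
        (interior_subset.trans Icc_subset_Ici_self)) fun t ht => ?_
    rw [interior_Icc] at ht
    nlinarith [mul_le_mul_of_nonneg_right (hdecay t (Ioo_subset_Ico_self ht))
      (Real.exp_pos (2 * c * t)).le]
  have hVt : ∀ t ∈ Icc 0 τ, V t ≤ V 0 * Real.exp (-(2 * c) * t) := by
    intro t ht
    have h := hanti (left_mem_Icc.2 hτ) ht ht.1
    simp only [mul_zero, Real.exp_zero, mul_one] at h
    rw [neg_mul, Real.exp_neg, ← div_eq_mul_inv, le_div_iff₀ (Real.exp_pos _)]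
    exact h
  refine ⟨hVt τ (right_mem_Icc.2 hτ), fun a ha => ?_⟩
  have hvt : ∀ t ∈ Ico 0 τ, ‖v t‖ ≤ S * Real.exp (-c * t) := by
    intro t ht
    have h1 : ‖v t‖ ^ 2 ≤ A * V 0 * Real.exp (-c * t) ^ 2 := by
      have := mul_le_mul_of_nonneg_left (hVt t (Ico_subset_Icc_self ht)) hA
      rw [← Real.exp_nat_mul, show ((2 : ℕ) : ℝ) * (-c * t) = -(2 * c) * t by push_cast; ring]
      linarith [hv t ht]
    have h2 := Real.le_sqrt_of_sq_le h1
    rwa [Real.sqrt_mul' _ (sq_nonneg _), Real.sqrt_sq (Real.exp_pos _).le, ← hS] at h2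
  have hS0 : 0 ≤ S := hS ▸ Real.sqrt_nonneg _
  have hB : ∀ t, HasDerivAt (fun t => S / c * (Real.exp (-c * a) - Real.exp (-c * t)))
      (S * Real.exp (-c * t)) t := by
    intro t
    have h := ((hexp (-c) t).const_sub (Real.exp (-c * a))).const_mul (S / c)
    rwa [show S / c * -(Real.exp (-c * t) * -c) = S * Real.exp (-c * t) by field_simp] at h
  have h := image_norm_le_of_norm_deriv_right_le_deriv_boundary (f := fun t => x t - x a)
    (f' := v) (a := a) (b := τ)
    (fun t ht => ((hx t (ha.1.trans ht.1)).continuousWithinAt.mono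
      (fun y hy => ha.1.trans hy.1)).sub continuousWithinAt_const)
    (fun t ht => ((hx t (ha.1.trans ht.1)).mono
      (fun y hy => (ha.1.trans ht.1).trans hy)).sub_const _)
    (by simp) hB (fun t ht => hvt t ⟨ha.1.trans ht.1, ht.2⟩) (right_mem_Icc.2 ha.2)
  refine h.trans (mul_le_mul_of_nonneg_left ?_ (by positivity))
  linarith [Real.exp_pos (-c * τ)]

theorem mem_ball_of_energy_decay {x v : ℝ → E} {V V' : ℝ → ℝ} {A c r : ℝ} {xs : E} (hA : 0 ≤ A)
    (hc : 0 < c)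
    (hx : ∀ t ∈ Ici (0 : ℝ), HasDerivWithinAt x (v t) (Ici (0 : ℝ)) t)
    (hV : ∀ t ∈ Ici (0 : ℝ), HasDerivWithinAt V (V' t) (Ici (0 : ℝ)) t)
    (hdecay : ∀ t, 0 ≤ t → x t ∈ Metric.ball xs r → V' t ≤ -(2 * c) * V t)
    (hv : ∀ t, 0 ≤ t → x t ∈ Metric.ball xs r → ‖v t‖ ^ 2 ≤ A * V t)
    (h0 : ‖x 0 - xs‖ + √(A * V 0) / c < r) {t : ℝ} (ht : 0 ≤ t) :
    x t ∈ Metric.ball xs r := by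
  by_contra hcon
  set S := Ici (0 : ℝ) ∩ x ⁻¹' (Metric.ball xs r)ᶜ
  have hS : IsClosed S := ContinuousOn.preimage_isClosed_of_isClosed
    (fun t ht => (hx t ht).continuousWithinAt) isClosed_Ici Metric.isOpen_ball.isClosed_compl
  have hbdd : BddBelow S := ⟨0, fun t ht => ht.1⟩
  have hmem : sInf S ∈ S := hS.csInf_mem ⟨t, ht, hcon⟩ hbdd
  have hlt : ∀ a ∈ Ico 0 (sInf S), x a ∈ Metric.ball xs r := by
    intro a ha
    by_contra h
    exact notMem_of_lt_csInf ha.2 hbdd ⟨ha.1, h⟩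
  have h := (displacement_le_of_energy_decay hA hc hx hV (fun a ha => hdecay a ha.1 (hlt a ha))
    (fun a ha => hv a ha.1 (hlt a ha)) rfl hmem.1).2 0 (left_mem_Icc.2 hmem.1)
  rw [mul_zero, Real.exp_zero, mul_one] at h
  apply hmem.2
  rw [mem_ball_iff_norm]
  have := norm_add_le (x (sInf S) - x 0) (x 0 - xs)
  rw [sub_add_sub_cancel] at this
  linarith

theorem HasDerivWithinAt.lyapunov {H : E →L[ℝ] E} (hH : ∀ v w, ⟪H v, w⟫ = ⟪v, H w⟫) (γ s : ℝ)
    {z v : ℝ → E} {z' v' : E} {I : Set ℝ} {t : ℝ} (hz : HasDerivWithinAt z z' I t)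
    (hv : HasDerivWithinAt v v' I t) :
    HasDerivWithinAt (fun t => lyapunov H γ s (z t) (v t))
      (2 * ⟪v t + s • z t, v' + s • z'⟫ + 2 * ⟪z', H (z t)⟫ +
        2 * (s ^ 2 - γ * s) * ⟪z t, z'⟫) I t := by
  have hHz : HasDerivWithinAt (fun t => H (z t)) (H z') I t :=
    H.hasFDerivAt.comp_hasDerivWithinAt t hz
  have h := ((hv.add (hz.const_smul s)).norm_sq.add (hz.inner ℝ hHz)).add
    (hz.norm_sq.const_mul (s ^ 2 - γ * s))
  refine h.congr_deriv ?_
  have h1 : ⟪z t, H z'⟫ = ⟪z', H (z t)⟫ := by rw [← hH, real_inner_comm]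
  rw [h1, Pi.add_apply, Pi.smul_apply]
  ring

theorem heavyBall_rate_spec {γ μ ε : ℝ} (hε : 0 < ε)
    (hερ : ε < (γ - √(max 0 (γ ^ 2 - 4 * μ))) / 2) :
    0 < (γ - √(max 0 (γ ^ 2 - 4 * μ))) / 2 - ε / 2 ∧
      2 * ((γ - √(max 0 (γ ^ 2 - 4 * μ))) / 2 - ε / 2) ≤ γ ∧
      0 < μ + (((γ - √(max 0 (γ ^ 2 - 4 * μ))) / 2 - ε / 2) ^ 2 -
        γ * ((γ - √(max 0 (γ ^ 2 - 4 * μ))) / 2 - ε / 2)) := by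
  have h1 := Real.sqrt_nonneg (max 0 (γ ^ 2 - 4 * μ))
  have h2 := Real.sq_sqrt (le_max_left 0 (γ ^ 2 - 4 * μ))
  have h3 := le_max_right 0 (γ ^ 2 - 4 * μ)
  refine ⟨by linarith, by linarith, ?_⟩
  nlinarith [mul_nonneg h1 hε.le]

theorem heavyBall_rate_pos {γ μ : ℝ} (hγ : 0 < γ) (hμ : 0 < μ) :
    0 < (γ - √(max 0 (γ ^ 2 - 4 * μ))) / 2 := by
  have : √(max 0 (γ ^ 2 - 4 * μ)) < γ :=
    (Real.sqrt_lt' hγ).2 (max_lt (by positivity) (by linarith))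
  linarith

theorem norm_le_of_norm_sub_le {H : E →L[ℝ] E} {w p z : E} {η : ℝ} (hη : η ≤ 1 / 2)
    (hHz : H z = w - p) (hp : ‖p‖ ≤ η * ‖w‖) : ‖w‖ ≤ 2 * ‖H‖ * ‖z‖ := by
  have h1 := norm_add_le (H z) p
  rw [hHz, sub_add_cancel, ← hHz] at h1
  nlinarith [H.le_opNorm z, norm_nonneg w]

/-- Near a minimizer satisfying the Polyak–Łojasiewicz inequality, the gradient and the velocity of
the heavy ball flow admit a Lyapunov function decaying at rate `2 * c`, for any `c < s`. -/
theorem exists_heavyBall_lyapunov [FiniteDimensional ℝ E] [CompleteSpace E] {f : E → ℝ}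
    (hf : ContDiff ℝ 2 f) {xs : E} (hmin : IsLocalMin f xs) {ν : ℝ} (hν : 0 < ν)
    (hPL : ∀ᶠ x in 𝓝 xs, 2 * ν * (f x - f xs) ≤ ‖gradient f x‖ ^ 2) {μ : ℝ}
    (hμ : ∀ c : ℝ, c ≠ 0 → (∃ v, v ≠ 0 ∧ fderiv ℝ (gradient f) xs v = c • v) → μ ≤ c)
    {γ s c : ℝ} (hs : 0 ≤ s) (hsγ : 2 * s ≤ γ) (hκ : 0 < μ + (s ^ 2 - γ * s)) (hcs : c < s) :
    ∃ (V V' : E → E → ℝ) (r A B D : ℝ), 0 < r ∧ 0 < A ∧ 0 < B ∧ 0 < D ∧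
      (∀ y ∈ Metric.ball xs r, f xs ≤ f y ∧ 2 * ν * (f y - f xs) ≤ ‖gradient f y‖ ^ 2 ∧
        ‖fderiv ℝ (gradient f) y‖ ≤ D) ∧
      (∀ y v, V y v ≤ B * (‖v‖ + ‖gradient f y‖) ^ 2) ∧
      (∀ y ∈ Metric.ball xs r, ∀ v, V' y v ≤ -(2 * c) * V y v ∧ ‖v‖ ^ 2 ≤ A * V y v ∧
        ‖gradient f y‖ ^ 2 ≤ A * V y v) ∧
      (∀ (x v : ℝ → E) (I : Set ℝ) (t : ℝ), HasDerivWithinAt x (v t) I t →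
        HasDerivWithinAt v (-(γ • v t) - gradient f (x t)) I t →
        HasDerivWithinAt (fun t => V (x t) (v t)) (V' (x t) (v t)) I t) := by
  set g := gradient f
  have hgd : Differentiable ℝ g := (contDiff_gradient hf).differentiable (by norm_num)
  set H := fderiv ℝ g xs
  have hH : ∀ v w, ⟪H v, w⟫ = ⟪v, H w⟫ := inner_fderiv_gradient_comm hf xs
  obtain ⟨P, T, hHP, hPort, hPsq, hHT, hTH, hPT, hco⟩ :=
    exists_kernel_projection_pseudoinverse H hH hμ
  set κ := μ + (s ^ 2 - γ * s)
  set K := 4 * ((s + ‖H‖ + |s ^ 2 - γ * s|) * (‖T‖ * (1 + s)) + 2 * ‖H‖) * (1 + 1 / κ)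
  have hK : 0 ≤ K := by positivity
  obtain ⟨η, hη, hη2, hηK⟩ : ∃ η > 0, η ≤ 1 / 2 ∧ η * K ≤ 2 * (s - c) := by
    have hsc : 0 < s - c := sub_pos.2 hcs
    refine ⟨min (1 / 2) (2 * (s - c) / (K + 1)), by positivity, min_le_left _ _, ?_⟩
    calc _ ≤ 2 * (s - c) / (K + 1) * (K + 1) :=
          mul_le_mul (min_le_right _ _) (by linarith) hK (by positivity)
      _ = _ := by field_simp
  obtain ⟨r, hr, hball⟩ := exists_ball_gradient_estimates hf hmin hν hPL P hHP hPsq hη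
  set m := 2 * (1 + 1 / κ)
  have hm : 0 < m := by positivity
  have hmco : ∀ w v : E, (‖v + s • T w‖ + ‖T w‖) ^ 2 ≤ m * lyapunov H γ s (T w) v := fun w v =>
    lyapunov_coercive hκ (hco _ (hPT w))
  refine ⟨fun y v => lyapunov H γ s (T (g y)) v,
    fun y v => 2 * ⟪v + s • T (g y), -(γ • v) - g y + s • T (fderiv ℝ g y v)⟫ +
      2 * ⟪T (fderiv ℝ g y v), H (T (g y))⟫ +
      2 * (s ^ 2 - γ * s) * ⟪T (g y), T (fderiv ℝ g y v)⟫, r,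
    ((1 + s) ^ 2 + (2 * ‖H‖) ^ 2) * m,
    (1 + s * ‖T‖) ^ 2 + (‖H‖ + |s ^ 2 - γ * s|) * ‖T‖ ^ 2, ‖H‖ + η, hr, by positivity,
    by positivity, by positivity, fun y hy => ?_, fun y v => lyapunov_le hs _ _,
    fun y hy v => ?_, fun x v I t hx hv => ?_⟩
  · obtain ⟨h1, h2, h3, -⟩ := hball y hy
    refine ⟨h1, h2, ?_⟩
    have := norm_add_le H (fderiv ℝ g y - H)
    rw [add_sub_cancel] at this
    linarith
  · obtain ⟨-, -, h3, h4⟩ := hball y hy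
    have hw : ‖g y‖ ≤ 2 * ‖H‖ * ‖T (g y)‖ := norm_le_of_norm_sub_le hη2 (hHT _) h4
    have hN := hmco (g y) v
    have hN0 : 0 ≤ m * lyapunov H γ s (T (g y)) v := (sq_nonneg _).trans hN
    have hV0 : 0 ≤ lyapunov H γ s (T (g y)) v := nonneg_of_mul_nonneg_right hN0 hm
    set N := ‖v + s • T (g y)‖ + ‖T (g y)‖
    have hzN : ‖T (g y)‖ ≤ N := by simp [N]
    have hvN : ‖v‖ ≤ (1 + s) * N := by
      have h := norm_sub_le (v + s • T (g y)) (s • T (g y))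
      rw [add_sub_cancel_right, norm_smul, Real.norm_of_nonneg hs] at h
      have huN : ‖v + s • T (g y)‖ ≤ N := by simp [N]
      nlinarith [mul_le_mul_of_nonneg_left hzN hs]
    have hwN : ‖g y‖ ≤ 2 * ‖H‖ * N :=
      hw.trans (mul_le_mul_of_nonneg_left hzN (by positivity))
    refine ⟨?_, ?_, ?_⟩
    · set e := T ((fderiv ℝ g y - H) v) with hedef
      have he : ‖e‖ ≤ ‖T‖ * η * ‖v‖ := by
        rw [mul_assoc]
        exact (T.le_opNorm _).trans (mul_le_mul_of_nonneg_left
          ((ContinuousLinearMap.le_opNorm _ _).trans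
            (mul_le_mul_of_nonneg_right h3 (norm_nonneg _))) (norm_nonneg _))
      have hp : ‖P (g y)‖ ≤ 2 * ‖H‖ * η * ‖T (g y)‖ :=
        h4.trans (by nlinarith [mul_le_mul_of_nonneg_left hw hη.le])
      have hz' : T (fderiv ℝ g y v) = v - P v + e := by
        rw [← hTH, hedef, ← map_add, sub_apply, add_sub_cancel]
      have hgy : g y = H (T (g y)) + P (g y) := by rw [hHT, sub_add_cancel]
      have hbound := lyapunov_perturbed_deriv_le hs hsγ hη.le (norm_nonneg T) hκ
        (hco _ (hPT (g y))) (hPort _ v (hPT (g y)))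
        (by rw [← hH, hHP, inner_zero_left]) (hPsq v) he hp
      beta_reduce
      rw [hz']
      rw [← hgy] at hbound
      refine hbound.trans ?_
      have := mul_le_mul_of_nonneg_right hηK hV0
      linarith
    · have := pow_le_pow_left₀ (norm_nonneg _) hvN 2
      have h5 := mul_le_mul_of_nonneg_left hN (sq_nonneg (1 + s))
      have h6 := mul_nonneg (sq_nonneg (2 * ‖H‖)) hN0
      linarith
    · have := pow_le_pow_left₀ (norm_nonneg _) hwN 2
      have h5 := mul_le_mul_of_nonneg_left hN (sq_nonneg (2 * ‖H‖))
      have h6 := mul_nonneg (sq_nonneg (1 + s)) hN0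
      linarith
  · have hz : HasDerivWithinAt (fun t => T (g (x t))) (T (fderiv ℝ g (x t) (v t))) I t :=
      T.hasFDerivAt.comp_hasDerivWithinAt t ((hgd (x t)).hasFDerivAt.comp_hasDerivWithinAt t hx)
    exact hz.lyapunov hH γ s hv

end HeavyBall

theorem isLocalMin_of_gradient_eq_zero_of_PL {E : Type*} [NormedAddCommGroup E]
    [InnerProductSpace ℝ E] [CompleteSpace E] {f : E → ℝ} {xs y : E} {r ν : ℝ} (hν : 0 < ν)
    (hball : ∀ y ∈ Metric.ball xs r, f xs ≤ f y ∧
      2 * ν * (f y - f xs) ≤ ‖gradient f y‖ ^ 2)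
    (hy : y ∈ Metric.ball xs r) (hgy : gradient f y = 0) : IsLocalMin f y ∧ f y = f xs := by
  obtain ⟨h1, h2⟩ := hball y hy
  rw [hgy, norm_zero] at h2
  have h3 : f y = f xs := by nlinarith
  refine ⟨?_, h3⟩
  filter_upwards [Metric.isOpen_ball.mem_nhds hy] with z hz
  rw [h3]
  exact (hball z hz).1

/-- Suppose `f : ℝ^d → ℝ` is `C²`, bounded below, and satisfies the local PL
condition at a local minimizer `xs`, with nonzero Hessian eigenvalues in `[μ, L]` on `𝒮` near
`xs`.  Fix `γ > 0` and `ρ_γ = (γ − √(max 0 (γ² − 4μ)))/2`.  For every sufficiently small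
`ε > 0` there are an open neighborhood `𝒰 ⊆ ℝ^d × ℝ^d` of `(xs, 0)` and `C_ε > 0` such that
every Heavy Ball trajectory with `(x(0), ẋ(0)) ∈ 𝒰` converges to some `x' ∈ 𝒮` and satisfies
`‖x(t) − x'‖ ≤ C_ε (‖x(0) − x'‖ + ‖ẋ(0)‖) e^{−(ρ_γ − ε)t}` for all `t ≥ 0`. -/
theorem stmt_3 {d : ℕ} (f : EuclideanSpace ℝ (Fin d) → ℝ) (hf : ContDiff ℝ 2 f)
    (hbdd : BddBelow (Set.range f)) (xs : EuclideanSpace ℝ (Fin d)) (hmin : IsLocalMin f xs)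
    (hPL : LocalPL f xs) (μ L : ℝ) (hμ : 0 < μ) (hμL : μ ≤ L)
    (hspec : ∃ V : Set (EuclideanSpace ℝ (Fin d)), IsOpen V ∧ xs ∈ V ∧
      ∀ p ∈ V, p ∈ minSet f xs → ∀ c : ℝ, c ≠ 0 →
        (∃ v, v ≠ 0 ∧ fderiv ℝ (gradient f) p v = c • v) → c ∈ Set.Icc μ L)
    (γ : ℝ) (hγ : 0 < γ) :
    ∃ ε₀ : ℝ, 0 < ε₀ ∧ ∀ ε : ℝ, 0 < ε → ε < ε₀ →
      ∃ 𝒰 : Set (EuclideanSpace ℝ (Fin d) × EuclideanSpace ℝ (Fin d)),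
        IsOpen 𝒰 ∧ (xs, (0 : EuclideanSpace ℝ (Fin d))) ∈ 𝒰 ∧
        ∃ C : ℝ, 0 < C ∧
          ∀ x v : ℝ → EuclideanSpace ℝ (Fin d), IsHeavyBall f γ x v → (x 0, v 0) ∈ 𝒰 →
            ∃ x' ∈ minSet f xs,
              Filter.Tendsto x Filter.atTop (nhds x') ∧
              ∀ t : ℝ, 0 ≤ t →
                ‖x t - x'‖ ≤ C * (‖x 0 - x'‖ + ‖v 0‖) *
                  Real.exp (-((γ - Real.sqrt (max 0 (γ ^ 2 - 4 * μ))) / 2 - ε) * t) := by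
  obtain ⟨U, hU, hxU, ν, hν, hPL⟩ := hPL
  obtain ⟨W, -, hxW, hW⟩ := hspec
  have hH : ∀ c : ℝ, c ≠ 0 → (∃ v, v ≠ 0 ∧ fderiv ℝ (gradient f) xs v = c • v) → μ ≤ c :=
    fun c hc hv => (hW xs hxW ⟨hmin, rfl⟩ c hc hv).1
  have hg : ContDiff ℝ 1 (gradient f) := contDiff_gradient hf
  refine ⟨_, heavyBall_rate_pos hγ hμ, fun ε hε hερ => ?_⟩
  obtain ⟨hs, hsγ, hκ⟩ := heavyBall_rate_spec hε hερ
  set c := (γ - √(max 0 (γ ^ 2 - 4 * μ))) / 2 - ε with hcdef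
  have hc : 0 < c := sub_pos.2 hερ
  obtain ⟨V, V', r, A, B, D, hr, hA, hB, hD, hball, hVle, hVball, hVderiv⟩ :=
    exists_heavyBall_lyapunov hf hmin hν
      (Filter.eventually_of_mem (hU.mem_nhds hxU) hPL) hH hs.le hsγ hκ
      (show c < _ by rw [hcdef]; linarith)
  set G : ℝ := √(A * B)
  have hG : 0 ≤ G := Real.sqrt_nonneg _
  have hgxs : gradient f xs = 0 := by simp [gradient, hmin.fderiv_eq_zero]
  refine ⟨{q | ‖q.1 - xs‖ + G * (‖q.2‖ + ‖gradient f q.1‖) / c < r}, ?_, ?_,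
    G * (1 + D) / c + 1, by positivity, fun x v hxv h0 => ?_⟩
  · have hgc := hg.continuous
    exact isOpen_lt (by fun_prop) continuous_const
  · simpa [hgxs] using hr
  obtain ⟨hx, hv⟩ := hxv
  have hder : ∀ t ∈ Set.Ici (0 : ℝ), HasDerivWithinAt (fun t => V (x t) (v t))
      (V' (x t) (v t)) (Set.Ici 0) t := fun t ht => hVderiv x v _ t (hx t ht) (hv t ht)
  set S := √(A * V (x 0) (v 0)) with hSdef
  have hS : S ≤ G * (‖v 0‖ + ‖gradient f (x 0)‖) := by
    rw [← Real.sqrt_sq (show 0 ≤ ‖v 0‖ + ‖gradient f (x 0)‖ by positivity),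
      ← Real.sqrt_mul (by positivity)]
    refine Real.sqrt_le_sqrt ?_
    rw [mul_assoc]
    exact mul_le_mul_of_nonneg_left (hVle _ _) hA.le
  have hS0 : 0 ≤ S := Real.sqrt_nonneg _
  have h0S : ‖x 0 - xs‖ + S / c < r := by
    refine lt_of_le_of_lt ?_ h0
    gcongr
  have hmem : ∀ t, 0 ≤ t → x t ∈ Metric.ball xs r := fun t ht =>
    mem_ball_of_energy_decay hA.le hc hx hder (fun t _ h => (hVball _ h _).1)
      (fun t _ h => (hVball _ h _).2.1) h0S ht
  have hdisp : ∀ t, 0 ≤ t → V (x t) (v t) ≤ V (x 0) (v 0) * Real.exp (-(2 * c) * t) ∧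
      ∀ a ∈ Set.Icc 0 t, ‖x t - x a‖ ≤ S / c * Real.exp (-c * a) := fun t ht =>
    displacement_le_of_energy_decay hA.le hc hx hder
      (fun a ha => (hVball _ (hmem a ha.1) _).1) (fun a ha => (hVball _ (hmem a ha.1) _).2.1)
      hSdef ht
  have hexp : ∀ k : ℝ, 0 < k →
      Filter.Tendsto (fun t : ℝ => Real.exp (-k * t)) Filter.atTop (nhds 0) := fun k hk =>
    Real.tendsto_exp_atBot.comp (Filter.tendsto_id.const_mul_atTop_of_neg (neg_lt_zero.2 hk))
  obtain ⟨x', hx'⟩ : ∃ x', Filter.Tendsto x Filter.atTop (nhds x') := by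
    refine cauchy_map_iff_exists_tendsto.1 (Metric.cauchy_iff.2 ⟨Filter.map_neBot, fun δ hδ => ?_⟩)
    have hlim : Filter.Tendsto (fun t : ℝ => S / c * Real.exp (-c * t)) Filter.atTop (nhds 0) := by
      simpa using (hexp c hc).const_mul (S / c)
    obtain ⟨a, ha, ha0⟩ := ((hlim.eventually_lt_const (half_pos hδ)).and
      (Filter.eventually_ge_atTop 0)).exists
    have hclose : ∀ t, a ≤ t → dist (x t) (x a) < δ / 2 := fun t ht => by
      rw [dist_eq_norm]
      exact ((hdisp t (ha0.trans ht)).2 a ⟨ha0, ht⟩).trans_lt ha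
    refine ⟨x '' Set.Ici a, Filter.image_mem_map (Filter.Ici_mem_atTop a), ?_⟩
    rintro _ ⟨t, ht, rfl⟩ _ ⟨u, hu, rfl⟩
    have := dist_triangle_right (x t) (x u) (x a)
    linarith [hclose t ht, hclose u hu]
  have hrate : ∀ t, 0 ≤ t → ‖x t - x'‖ ≤ S / c * Real.exp (-c * t) := by
    intro t ht
    rw [norm_sub_rev]
    refine le_of_tendsto (hx'.sub_const (x t)).norm ?_
    filter_upwards [Filter.eventually_ge_atTop t] with u hu
    exact (hdisp u (ht.trans hu)).2 t ⟨ht, hu⟩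
  have hx'mem : x' ∈ Metric.ball xs r := by
    rw [mem_ball_iff_norm]
    have h1 := hrate 0 le_rfl
    rw [mul_zero, Real.exp_zero, mul_one, norm_sub_rev] at h1
    have := norm_add_le (x' - x 0) (x 0 - xs)
    rw [sub_add_sub_cancel] at this
    linarith
  have hgx' : gradient f x' = 0 := by
    have h1 : Filter.Tendsto (fun t => ‖gradient f (x t)‖ ^ 2) Filter.atTop
        (nhds (‖gradient f x'‖ ^ 2)) := (((hg.continuous.tendsto x').comp hx').norm).pow 2
    have h2 : Filter.Tendsto (fun t : ℝ => A * (V (x 0) (v 0) * Real.exp (-(2 * c) * t)))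
        Filter.atTop (nhds 0) := by
      simpa using ((hexp (2 * c) (by positivity)).const_mul (V (x 0) (v 0))).const_mul A
    have h3 : ‖gradient f x'‖ ^ 2 ≤ 0 := by
      refine le_of_tendsto_of_tendsto h1 h2 ?_
      filter_upwards [Filter.eventually_ge_atTop 0] with t ht
      exact (hVball _ (hmem t ht) (v t)).2.2.trans
        (mul_le_mul_of_nonneg_left (hdisp t ht).1 hA.le)
    exact norm_eq_zero.1 (pow_eq_zero_iff two_ne_zero |>.1 (le_antisymm h3 (sq_nonneg _)))
  refine ⟨x', isLocalMin_of_gradient_eq_zero_of_PL hν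
    (fun y hy => ⟨(hball y hy).1, (hball y hy).2.1⟩) hx'mem hgx', hx', fun t ht => ?_⟩
  refine (hrate t ht).trans (mul_le_mul_of_nonneg_right ?_ (Real.exp_pos _).le)
  have hlip : ‖gradient f (x 0)‖ ≤ D * ‖x 0 - x'‖ := by
    simpa [hgx'] using (convex_ball xs r).norm_image_sub_le_of_norm_fderiv_le (𝕜 := ℝ)
      (fun y _ => hg.differentiable (by norm_num) y) (fun y hy => (hball y hy).2.2) hx'mem
      (hmem 0 le_rfl)
  have h1 : ‖v 0‖ + ‖gradient f (x 0)‖ ≤ (1 + D) * (‖x 0 - x'‖ + ‖v 0‖) := by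
    nlinarith [norm_nonneg (x 0 - x'), norm_nonneg (v 0)]
  calc S / c ≤ G * ((1 + D) * (‖x 0 - x'‖ + ‖v 0‖)) / c := by
        gcongr
        exact hS.trans (mul_le_mul_of_nonneg_left h1 hG)
    _ = G * (1 + D) / c * (‖x 0 - x'‖ + ‖v 0‖) := by ring
    _ ≤ _ := by
        gcongr
        linarith
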